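/- arXiv:1307.5923 — 2 statements merged into one kernel-verified Lean document; each statement's English description precedes it below -/
import Mathlib

section
/- For all integers j, k ≥ 0 and n with j + k ≤ n: ∫_{B₃} (C_{n−j−k}^{j+k+3/2}(x))²·(1−x²)^j·(C_j^{k+1}(y/√(1−x²)))²·(1−x²−y²)^k·(C_k^{1/2}(z/√(1−x²−y²)))² dx dy dz = (N_k^{[1/2]})²·(N_j^{[k+1]})²·(N_{n−j−k}^{[j+k+3/2]})², where (N_m^{[μ]})² = π·Γ(2μ+m) / (2^{2μ−1}·m!·(μ+m)·Γ(μ)²). -/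
open MeasureTheory Real Filter

/-- The Gegenbauer polynomials `C_n^λ`, defined by their triple recursion. -/
noncomputable def gegenbauer (lam : ℝ) : ℕ → ℝ → ℝ
  | 0, _ => 1
  | 1, t => 2 * lam * t
  | (n + 2), t =>
      (2 * (((n : ℝ) + 1) + lam) / ((n : ℝ) + 2)) * t * gegenbauer lam (n + 1) t
        - ((((n : ℝ) + 1) + 2 * lam - 1) / ((n : ℝ) + 2)) * gegenbauer lam n t

/-- The open unit ball in `ℝ³`. -/
def unitBall3 : Set (ℝ × ℝ × ℝ) := {p | p.1 ^ 2 + p.2.1 ^ 2 + p.2.2 ^ 2 < 1}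

/-- `(N_m^{[μ]})²`, the squared weighted `L²`-norm of the Gegenbauer
polynomial `C_m^μ`. -/
noncomputable def Nsq (mu : ℝ) (m : ℕ) : ℝ :=
  π * Real.Gamma (2 * mu + m) /
    ((2 : ℝ) ^ (2 * mu - 1) * (Nat.factorial m : ℝ) * (mu + m) * Real.Gamma mu ^ 2)

/-- The normalization constant `h_{j,k,n}`. -/
noncomputable def h3 (j k n : ℕ) : ℝ :=
  Real.sqrt (Nsq (1 / 2) k * Nsq ((k : ℝ) + 1) j *
    Nsq ((j : ℝ) + (k : ℝ) + 3 / 2) (n - j - k))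

/-- The orthonormal polynomial basis `Q_n^{j,k}` on the unit ball. -/
noncomputable def Q3 (n j k : ℕ) (x y z : ℝ) : ℝ :=
  (1 / h3 j k n) * gegenbauer ((j : ℝ) + (k : ℝ) + 3 / 2) (n - j - k) x *
    (1 - x ^ 2) ^ ((j : ℝ) / 2) * gegenbauer ((k : ℝ) + 1) j (y / Real.sqrt (1 - x ^ 2)) *
    (1 - x ^ 2 - y ^ 2) ^ ((k : ℝ) / 2) *
    gegenbauer (1 / 2) k (z / Real.sqrt (1 - x ^ 2 - y ^ 2))

lemma gegenbauer_recurrence (lam : ℝ) (n : ℕ) (t : ℝ) :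
    ((n : ℝ) + 2) * gegenbauer lam (n + 2) t =
      2 * ((n : ℝ) + 1 + lam) * t * gegenbauer lam (n + 1) t
        - ((n : ℝ) + 2 * lam) * gegenbauer lam n t := by
  have h : (n : ℝ) + 2 ≠ 0 := by positivity
  rw [gegenbauer]
  field_simp
  ring

lemma gegenbauer_raise_parameter (lam t : ℝ) (n : ℕ) :
    ((n : ℝ) + 1 + 2 * lam) * gegenbauer lam (n + 1) t =
        2 * lam * (gegenbauer (lam + 1) (n + 1) t - t * gegenbauer (lam + 1) n t) ∧
      ((n : ℝ) + 2) * gegenbauer lam (n + 2) t =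
        2 * lam * (t * gegenbauer (lam + 1) (n + 1) t - gegenbauer (lam + 1) n t) := by
  induction n with
  | zero =>
    have h := gegenbauer_recurrence lam 0 t
    simp only [gegenbauer, Nat.cast_zero, zero_add] at h ⊢
    constructor <;> ring
  | succ n ih =>
    have hC := gegenbauer_recurrence lam (n + 1) t
    have hB := gegenbauer_recurrence (lam + 1) n t
    obtain ⟨h1, h2⟩ := ih
    have h3 : ((n : ℝ) + 2 + 2 * lam) * gegenbauer lam (n + 2) t =
        2 * lam * (gegenbauer (lam + 1) (n + 2) t - t * gegenbauer (lam + 1) (n + 1) t) := by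
      have h : (n : ℝ) + 2 ≠ 0 := by positivity
      apply mul_left_cancel₀ h
      linear_combination (n + 2 + 2 * lam) * h2 - 2 * lam * hB
    push_cast at hC ⊢
    constructor
    · linear_combination h3
    · linear_combination hC + t * h3 + t * h2 - h1

lemma continuous_gegenbauer (lam : ℝ) (n : ℕ) : Continuous (gegenbauer lam n) := by
  induction n using Nat.twoStepInduction with
  | zero => exact continuous_const
  | one => exact continuous_const.mul continuous_id
  | more n h₀ h₁ =>
    change Continuous fun t => gegenbauer lam (n + 2) t
    simp only [gegenbauer]
    fun_prop

lemma hasDerivAt_gegenbauer (lam : ℝ) (n : ℕ) (t : ℝ) :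
    HasDerivAt (gegenbauer lam (n + 1)) (2 * lam * gegenbauer (lam + 1) n t) t := by
  induction n using Nat.twoStepInduction with
  | zero => simpa [gegenbauer] using (hasDerivAt_id t).const_mul (2 * lam)
  | one =>
    have h := (((hasDerivAt_id t).const_mul (2 * (1 + lam) / 2)).mul
      ((hasDerivAt_id t).const_mul (2 * lam))).sub_const (2 * lam / 2)
    convert! h using 1
    · funext s
      simp [gegenbauer]
    · simp [gegenbauer]
      ring
  | more n h₀ h₁ =>
    have h : (n : ℝ) + 3 ≠ 0 := by positivity
    have hd := ((((hasDerivAt_id t).mul h₁).const_mul (2 * ((n : ℝ) + 2 + lam))).sub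
      (h₀.const_mul ((n : ℝ) + 1 + 2 * lam))).const_mul ((n : ℝ) + 3)⁻¹
    convert! hd using 1
    · funext s
      have hr := gegenbauer_recurrence lam (n + 1) s
      push_cast at hr
      apply mul_left_cancel₀ h
      simp only [Pi.mul_apply, Pi.sub_apply, id_eq]
      rw [mul_inv_cancel_left₀ h]
      linear_combination hr
    · have hB := gegenbauer_recurrence (lam + 1) n t
      obtain ⟨h1, -⟩ := gegenbauer_raise_parameter lam t (n + 1)
      obtain ⟨-, h2⟩ := gegenbauer_raise_parameter lam t n
      push_cast at h1
      apply mul_left_cancel₀ h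
      rw [mul_inv_cancel_left₀ h]
      simp only [id_eq]
      linear_combination 2 * lam * hB - h2 - h1

/-- The lowering relation, in terms of the Gegenbauer polynomials of parameter `lam` and the
derivative of those of parameter `lam + 1`. -/
lemma hasDerivAt_gegenbauer_succ_parameter (lam : ℝ) (n : ℕ) (t : ℝ) :
    ∃ d, HasDerivAt (gegenbauer (lam + 1) n) d t ∧
      2 * lam * ((1 - t ^ 2) * d - (2 * lam + 1) * t * gegenbauer (lam + 1) n t) =
        -(((n : ℝ) + 1) * ((n : ℝ) + 1 + 2 * lam)) * gegenbauer lam (n + 1) t := by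
  obtain _ | n := n
  · refine ⟨0, hasDerivAt_const t 1, ?_⟩
    simp [gegenbauer]
    ring
  · refine ⟨_, hasDerivAt_gegenbauer (lam + 1) n t, ?_⟩
    obtain ⟨h1, h2⟩ := gegenbauer_raise_parameter (lam + 1) t n
    obtain ⟨h3, -⟩ := gegenbauer_raise_parameter lam t (n + 1)
    push_cast at h3 ⊢
    linear_combination -2 * lam * t * h1 + 2 * lam * h2 + (n + 2) * h3

lemma hasDerivAt_one_sub_sq_rpow {p : ℝ} (hp : 1 ≤ p) (t : ℝ) :
    HasDerivAt (fun x : ℝ => (1 - x ^ 2) ^ p) (-(2 * t) * p * (1 - t ^ 2) ^ (p - 1)) t := by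
  have h : HasDerivAt (fun x : ℝ => 1 - x ^ 2) (-(2 * t)) t := by
    simpa using (hasDerivAt_pow 2 t).const_sub 1
  exact h.rpow_const (Or.inr hp)

lemma continuous_one_sub_sq_rpow {p : ℝ} (hp : 0 ≤ p) :
    Continuous fun x : ℝ => (1 - x ^ 2) ^ p :=
  (by fun_prop : Continuous fun x : ℝ => 1 - x ^ 2).rpow_const fun _ => Or.inr hp

lemma integral_gegenbauer_sq_succ {mu : ℝ} (hmu : 1 / 2 ≤ mu) (n : ℕ) :
    ((n : ℝ) + 1) * ((n : ℝ) + 1 + 2 * mu) *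
        ∫ x in (-1 : ℝ)..1, gegenbauer mu (n + 1) x ^ 2 * (1 - x ^ 2) ^ (mu - 1 / 2) =
      4 * mu ^ 2 * ∫ x in (-1 : ℝ)..1,
        gegenbauer (mu + 1) n x ^ 2 * (1 - x ^ 2) ^ (mu + 1 - 1 / 2) := by
  have hmu0 : 0 < mu := by linarith
  have hC := continuous_gegenbauer mu (n + 1)
  have hB := continuous_gegenbauer (mu + 1) n
  have hw := continuous_one_sub_sq_rpow (p := mu - 1 / 2) (by linarith)
  have hv : ∀ x ∈ Set.uIcc (-1 : ℝ) 1, HasDerivAt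
      (fun x => gegenbauer (mu + 1) n x * (1 - x ^ 2) ^ (mu + 1 / 2))
      (-(((n : ℝ) + 1) * ((n : ℝ) + 1 + 2 * mu)) / (2 * mu) *
        (gegenbauer mu (n + 1) x * (1 - x ^ 2) ^ (mu - 1 / 2))) x := by
    intro x hx
    rw [Set.uIcc_of_le (by norm_num)] at hx
    obtain ⟨d, hd, he⟩ := hasDerivAt_gegenbauer_succ_parameter mu n x
    convert! hd.mul (hasDerivAt_one_sub_sq_rpow (p := mu + 1 / 2) (by linarith) x) using 1
    have hx0 : 0 ≤ 1 - x ^ 2 := by nlinarith [hx.1, hx.2]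
    have hp : (1 - x ^ 2) ^ (mu + 1 / 2) = (1 - x ^ 2) ^ (mu - 1 / 2) * (1 - x ^ 2) := by
      rw [show mu + 1 / 2 = mu - 1 / 2 + 1 by ring, Real.rpow_add_one' hx0 (by linarith)]
    rw [hp, show mu + 1 / 2 - 1 = mu - 1 / 2 by ring]
    generalize (1 - x ^ 2) ^ (mu - 1 / 2) = w
    field_simp
    linear_combination -w * he
  have key := intervalIntegral.integral_mul_deriv_eq_deriv_mul
    (fun x _ => hasDerivAt_gegenbauer mu n x) hv
    (Continuous.intervalIntegrable (by fun_prop) _ _)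
    (Continuous.intervalIntegrable (by fun_prop) _ _)
  have hz : (0 : ℝ) ^ (mu + 1 / 2) = 0 := Real.zero_rpow (by linarith)
  have e1 : (∫ x in (-1 : ℝ)..1, gegenbauer mu (n + 1) x *
      (-(((n : ℝ) + 1) * ((n : ℝ) + 1 + 2 * mu)) / (2 * mu) *
        (gegenbauer mu (n + 1) x * (1 - x ^ 2) ^ (mu - 1 / 2)))) =
      -(((n : ℝ) + 1) * ((n : ℝ) + 1 + 2 * mu)) / (2 * mu) *
        ∫ x in (-1 : ℝ)..1, gegenbauer mu (n + 1) x ^ 2 * (1 - x ^ 2) ^ (mu - 1 / 2) := by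
    rw [← intervalIntegral.integral_const_mul]
    congr 1
    funext x
    ring
  have e2 : (∫ x in (-1 : ℝ)..1, 2 * mu * gegenbauer (mu + 1) n x *
      (gegenbauer (mu + 1) n x * (1 - x ^ 2) ^ (mu + 1 / 2))) =
      2 * mu * ∫ x in (-1 : ℝ)..1,
        gegenbauer (mu + 1) n x ^ 2 * (1 - x ^ 2) ^ (mu + 1 - 1 / 2) := by
    rw [← intervalIntegral.integral_const_mul]
    congr 1
    funext x
    rw [show mu + 1 - 1 / 2 = mu + 1 / 2 by ring]
    ring
  rw [e1, e2] at key
  generalize (∫ x in (-1 : ℝ)..1,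
    gegenbauer mu (n + 1) x ^ 2 * (1 - x ^ 2) ^ (mu - 1 / 2)) = I at key ⊢
  generalize (∫ x in (-1 : ℝ)..1,
    gegenbauer (mu + 1) n x ^ 2 * (1 - x ^ 2) ^ (mu + 1 - 1 / 2)) = J at key ⊢
  simp only [neg_sq, one_pow, sub_self, hz, mul_zero, zero_sub] at key
  field_simp at key
  linear_combination -key

lemma integral_one_sub_sq_rpow {p : ℝ} (hp : 0 ≤ p) :
    ∫ x in (-1 : ℝ)..1, (1 - x ^ 2) ^ p =
      2 ^ (2 * p + 1) * (Real.Gamma (p + 1) ^ 2 / Real.Gamma (2 * p + 2)) := by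
  have hbeta : ∫ x in (0 : ℝ)..1, x ^ p * (1 - x) ^ p =
      Real.Gamma (p + 1) ^ 2 / Real.Gamma (2 * p + 2) := by
    have h := ProbabilityTheory.beta_eq_betaIntegralReal (p + 1) (p + 1)
      (by linarith) (by linarith)
    rw [ProbabilityTheory.beta, show p + 1 + (p + 1) = 2 * p + 2 by ring, ← sq] at h
    rw [h, Complex.betaIntegral]
    have e : (∫ x in (0 : ℝ)..1, (x : ℂ) ^ (((p + 1 : ℝ) : ℂ) - 1) *
        (1 - (x : ℂ)) ^ (((p + 1 : ℝ) : ℂ) - 1)) =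
        ∫ x in (0 : ℝ)..1, ((x ^ p * (1 - x) ^ p : ℝ) : ℂ) := by
      apply intervalIntegral.integral_congr
      intro x hx
      rw [Set.uIcc_of_le zero_le_one] at hx
      simp only [Complex.ofReal_add, Complex.ofReal_one, add_sub_cancel_right]
      rw [Complex.ofReal_mul, Complex.ofReal_cpow hx.1, Complex.ofReal_cpow (by linarith [hx.2])]
      push_cast
      rfl
    rw [e, intervalIntegral.integral_ofReal, Complex.ofReal_re]
  have hsub := intervalIntegral.integral_comp_mul_sub
    (fun x : ℝ => (1 - x ^ 2) ^ p) (a := 0) (b := 1) (c := 2) two_ne_zero 1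
  norm_num at hsub
  rw [← hbeta]
  have e : (∫ x in (0 : ℝ)..1, (1 - (2 * x - 1) ^ 2) ^ p) =
      2 ^ (2 * p) * ∫ x in (0 : ℝ)..1, x ^ p * (1 - x) ^ p := by
    rw [← intervalIntegral.integral_const_mul]
    apply intervalIntegral.integral_congr
    intro x hx
    rw [Set.uIcc_of_le zero_le_one] at hx
    have hx1 : 0 ≤ 1 - x := by linarith [hx.2]
    simp only
    rw [show 1 - (2 * x - 1) ^ 2 = 2 ^ 2 * (x * (1 - x)) by ring,
      Real.mul_rpow (by norm_num) (mul_nonneg hx.1 hx1), Real.mul_rpow hx.1 hx1,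
      Real.rpow_mul (by norm_num), Real.rpow_two]
  rw [Real.rpow_add_one two_ne_zero]
  linear_combination -2 * hsub + 2 * e

/-- The squared weighted `L²`-norm of a Gegenbauer polynomial. -/
lemma integral_gegenbauer_sq {mu : ℝ} (hmu : 1 / 2 ≤ mu) (n : ℕ) :
    ∫ x in (-1 : ℝ)..1, gegenbauer mu n x ^ 2 * (1 - x ^ 2) ^ (mu - 1 / 2) = Nsq mu n := by
  induction n generalizing mu with
  | zero =>
    have hmu0 : 0 < mu := by linarith
    have hG := (Real.Gamma_pos_of_pos hmu0).ne'
    have hG2 := (Real.Gamma_pos_of_pos (by linarith : 0 < 2 * mu)).ne'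
    have hdup := Real.Gamma_mul_Gamma_add_half mu
    have hsq : √π ^ 2 = π := Real.sq_sqrt Real.pi_pos.le
    simp only [gegenbauer, one_pow, one_mul, Nsq, Nat.cast_zero, add_zero, Nat.factorial_zero,
      Nat.cast_one, mul_one]
    rw [integral_one_sub_sq_rpow (by linarith), show 2 * (mu - 1 / 2) + 1 = 2 * mu by ring,
      show mu - 1 / 2 + 1 = mu + 1 / 2 by ring, show 2 * (mu - 1 / 2) + 2 = 2 * mu + 1 by ring,
      Real.Gamma_add_one (by positivity), eq_div_of_mul_eq hG ((mul_comm _ _).trans hdup),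
      Real.rpow_sub two_pos, Real.rpow_sub two_pos, Real.rpow_one]
    have h2 : (2 : ℝ) ^ (2 * mu) ≠ 0 := by positivity
    field_simp
    rw [hsq]
  | succ n ih =>
    have hmu0 : 0 < mu := by linarith
    have hG := (Real.Gamma_pos_of_pos hmu0).ne'
    have h := integral_gegenbauer_sq_succ hmu n
    rw [ih (by linarith)] at h
    have hc : ((n : ℝ) + 1) * ((n : ℝ) + 1 + 2 * mu) ≠ 0 := by positivity
    apply mul_left_cancel₀ hc
    rw [h, Nsq, Nsq, Real.Gamma_add_one hmu0.ne', Nat.factorial_succ]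
    push_cast
    rw [show 2 * (mu + 1) + (n : ℝ) = 2 * mu + (n + 1) + 1 by ring,
      Real.Gamma_add_one (by positivity),
      show 2 * (mu + 1) - 1 = 2 * mu - 1 + (2 : ℕ) by push_cast; ring,
      Real.rpow_add_natCast two_ne_zero]
    have h2 : (2 : ℝ) ^ (2 * mu - 1) ≠ 0 := by positivity
    have hf : (n.factorial : ℝ) ≠ 0 := by positivity
    have h3 : mu + 1 + n ≠ 0 := by positivity
    have h4 : mu + (n + 1) ≠ 0 := by positivity
    field_simp
    ring

lemma integral_ite_sq_lt (g : ℝ → ℝ) (s : ℝ) :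
    ∫ z : ℝ, (if z ^ 2 < s then g (z / √s) else 0) = √s * ∫ t in (-1 : ℝ)..1, g t := by
  obtain hs | hs := le_or_gt s 0
  · have h : ∀ z : ℝ, ¬ z ^ 2 < s := fun z => not_lt.2 (hs.trans (sq_nonneg z))
    simp [h, Real.sqrt_eq_zero_of_nonpos hs]
  · have hr : 0 < √s := Real.sqrt_pos.2 hs
    have h : (fun z : ℝ => if z ^ 2 < s then g (z / √s) else 0) =
        (Set.Ioo (-√s) √s).indicator fun z => g (z / √s) := by
      funext z
      simp only [Set.indicator_apply, Set.mem_Ioo, Real.sq_lt]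
    rw [h, integral_indicator measurableSet_Ioo, ← integral_Ioc_eq_integral_Ioo,
      ← intervalIntegral.integral_of_le (by linarith), intervalIntegral.integral_comp_div _ hr.ne',
      neg_div, div_self hr.ne', smul_eq_mul]

lemma sqrt_mul_pow_eq_rpow {r : ℝ} (hr : 0 ≤ r) (k : ℕ) : √r * r ^ k = r ^ ((k : ℝ) + 1 / 2) := by
  rw [Real.rpow_add_of_nonneg hr k.cast_nonneg (by norm_num), Real.rpow_natCast,
    ← Real.sqrt_eq_rpow, mul_comm]

lemma exists_forall_sq_gegenbauer_le (lam : ℝ) (n : ℕ) :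
    ∃ M : ℝ, ∀ t : ℝ, t ^ 2 ≤ 1 → gegenbauer lam n t ^ 2 ≤ M := by
  obtain ⟨M, hM⟩ := isCompact_Icc.exists_bound_of_continuousOn (s := Set.Icc (-1 : ℝ) 1)
    ((continuous_gegenbauer lam n).pow 2).continuousOn
  refine ⟨M, fun t ht => (le_abs_self _).trans (hM t ?_)⟩
  exact abs_le.1 ((sq_le_one_iff_abs_le_one t).1 ht)

lemma measurableSet_unitBall3 : MeasurableSet unitBall3 :=
  measurableSet_lt (by fun_prop) measurable_const

lemma volume_unitBall3_lt_top : volume unitBall3 < ⊤ := by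
  refine (measure_mono (t := Metric.closedBall 0 1) ?_).trans_lt measure_closedBall_lt_top
  rintro ⟨x, y, z⟩ h
  simp only [unitBall3, Set.mem_ofPred_eq] at h
  simp only [mem_closedBall_zero_iff, Prod.norm_def, Real.norm_eq_abs, sup_le_iff,
    ← sq_le_one_iff_abs_le_one]
  refine ⟨?_, ?_, ?_⟩ <;> nlinarith [sq_nonneg x, sq_nonneg y, sq_nonneg z]

lemma div_sqrt_sq_le_one {y s : ℝ} (h : y ^ 2 ≤ s) : (y / √s) ^ 2 ≤ 1 := by
  have hs : 0 ≤ s := (sq_nonneg y).trans h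
  rw [div_pow, Real.sq_sqrt hs]
  exact div_le_one_of_le₀ h hs

/-- The square of the unnormalized basis function of degree `j + k + m` on the unit ball. -/
noncomputable def ballBasisSq (j k m : ℕ) (p : ℝ × ℝ × ℝ) : ℝ :=
  (gegenbauer ((j : ℝ) + (k : ℝ) + 3 / 2) m p.1) ^ 2 *
    (1 - p.1 ^ 2) ^ j *
    (gegenbauer ((k : ℝ) + 1) j (p.2.1 / Real.sqrt (1 - p.1 ^ 2))) ^ 2 *
    (1 - p.1 ^ 2 - p.2.1 ^ 2) ^ k *
    (gegenbauer (1 / 2) k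
      (p.2.2 / Real.sqrt (1 - p.1 ^ 2 - p.2.1 ^ 2))) ^ 2

lemma integrableOn_ballBasisSq (j k m : ℕ) : IntegrableOn (ballBasisSq j k m) unitBall3 := by
  obtain ⟨A, hA⟩ := exists_forall_sq_gegenbauer_le ((j : ℝ) + (k : ℝ) + 3 / 2) m
  obtain ⟨B, hB⟩ := exists_forall_sq_gegenbauer_le ((k : ℝ) + 1) j
  obtain ⟨C, hC⟩ := exists_forall_sq_gegenbauer_le (1 / 2) k
  have hm1 := (continuous_gegenbauer ((j : ℝ) + (k : ℝ) + 3 / 2) m).measurable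
  have hm2 := (continuous_gegenbauer ((k : ℝ) + 1) j).measurable
  have hm3 := (continuous_gegenbauer (1 / 2) k).measurable
  have hmeas : Measurable (ballBasisSq j k m) := by
    unfold ballBasisSq
    fun_prop
  refine Measure.integrableOn_of_bounded (M := A * 1 * B * 1 * C) volume_unitBall3_lt_top.ne
    hmeas.aestronglyMeasurable ?_
  refine (ae_restrict_iff' measurableSet_unitBall3).2 (Eventually.of_forall ?_)
  rintro ⟨x, y, z⟩ h
  simp only [unitBall3, Set.mem_ofPred_eq] at h
  have hx := sq_nonneg x
  have hy := sq_nonneg y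
  have hz := sq_nonneg z
  have hs : 0 ≤ 1 - x ^ 2 := by linarith
  have hr : 0 ≤ 1 - x ^ 2 - y ^ 2 := by linarith
  have a := hA x (by linarith)
  have b := hB (y / √(1 - x ^ 2)) (div_sqrt_sq_le_one (by linarith))
  have c := hC (z / √(1 - x ^ 2 - y ^ 2)) (div_sqrt_sq_le_one (by linarith))
  have hA0 : 0 ≤ A := (sq_nonneg _).trans a
  have hB0 : 0 ≤ B := (sq_nonneg _).trans b
  have hs1 : (1 - x ^ 2) ^ j ≤ 1 := pow_le_one₀ hs (by linarith)
  have hr1 : (1 - x ^ 2 - y ^ 2) ^ k ≤ 1 := pow_le_one₀ hr (by linarith)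
  have hsj := pow_nonneg hs j
  have hrk := pow_nonneg hr k
  simp only [ballBasisSq]
  rw [Real.norm_of_nonneg (by positivity)]
  gcongr

lemma integral_indicator_ballBasisSq_third (j k m : ℕ) (x y : ℝ) :
    ∫ z, unitBall3.indicator (ballBasisSq j k m) (x, y, z) =
      √(1 - x ^ 2 - y ^ 2) * ((gegenbauer ((j : ℝ) + (k : ℝ) + 3 / 2) m x) ^ 2 *
        (1 - x ^ 2) ^ j * (gegenbauer ((k : ℝ) + 1) j (y / √(1 - x ^ 2))) ^ 2 *
        (1 - x ^ 2 - y ^ 2) ^ k * Nsq (1 / 2) k) := by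
  have hN := integral_gegenbauer_sq (mu := 1 / 2) le_rfl k
  simp only [sub_self, Real.rpow_zero, mul_one] at hN
  rw [← hN, ← intervalIntegral.integral_const_mul, ← integral_ite_sq_lt]
  refine congrArg (integral volume) (funext fun z => ?_)
  have hiff : (x, y, z) ∈ unitBall3 ↔ z ^ 2 < 1 - x ^ 2 - y ^ 2 := by
    simp only [unitBall3, Set.mem_ofPred_eq]
    constructor <;> intro h <;> linarith
  split_ifs with h
  · exact Set.indicator_of_mem (hiff.2 h) _
  · exact Set.indicator_of_notMem (mt hiff.1 h) _

lemma integral_integral_indicator_ballBasisSq (j k m : ℕ) (x : ℝ) :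
    ∫ y, ∫ z, unitBall3.indicator (ballBasisSq j k m) (x, y, z) =
      √(1 - x ^ 2) * ((gegenbauer ((j : ℝ) + (k : ℝ) + 3 / 2) m x) ^ 2 *
        (1 - x ^ 2) ^ j * (1 - x ^ 2) ^ ((k : ℝ) + 1 / 2) * Nsq (1 / 2) k *
        Nsq ((k : ℝ) + 1) j) := by
  have hk : (0 : ℝ) ≤ k := k.cast_nonneg
  rw [← integral_gegenbauer_sq (mu := (k : ℝ) + 1) (by linarith) j,
    ← intervalIntegral.integral_const_mul, ← integral_ite_sq_lt]
  refine congrArg (integral volume) (funext fun y => ?_)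
  rw [integral_indicator_ballBasisSq_third]
  split_ifs with h
  · have hs : 0 < 1 - x ^ 2 := (sq_nonneg y).trans_lt h
    have hr : 1 - x ^ 2 - y ^ 2 = (1 - x ^ 2) * (1 - (y / √(1 - x ^ 2)) ^ 2) := by
      rw [div_pow, Real.sq_sqrt hs.le]
      field_simp
    have hp := sqrt_mul_pow_eq_rpow (r := 1 - x ^ 2 - y ^ 2) (by linarith) k
    rw [hr, Real.mul_rpow hs.le (by linarith [div_sqrt_sq_le_one h.le]), ← hr] at hp
    rw [show (k : ℝ) + 1 - 1 / 2 = k + 1 / 2 by ring]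
    linear_combination (gegenbauer ((j : ℝ) + (k : ℝ) + 3 / 2) m x) ^ 2 *
        (1 - x ^ 2) ^ j * (gegenbauer ((k : ℝ) + 1) j (y / √(1 - x ^ 2))) ^ 2 *
        Nsq (1 / 2) k * hp
  · rw [Real.sqrt_eq_zero_of_nonpos (by linarith), zero_mul]

lemma integral_ballBasisSq (j k m : ℕ) :
    ∫ p in unitBall3, ballBasisSq j k m p =
      Nsq (1 / 2) k * Nsq ((k : ℝ) + 1) j * Nsq ((j : ℝ) + (k : ℝ) + 3 / 2) m := by
  have hint := (integrable_indicator_iff measurableSet_unitBall3).2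
    (integrableOn_ballBasisSq j k m)
  have hj : (0 : ℝ) ≤ j := j.cast_nonneg
  have hk : (0 : ℝ) ≤ k := k.cast_nonneg
  rw [← integral_indicator measurableSet_unitBall3]
  rw [Measure.volume_eq_prod] at hint ⊢
  rw [integral_prod _ hint,
    ← integral_gegenbauer_sq (mu := (j : ℝ) + (k : ℝ) + 3 / 2) (by linarith) m,
    ← intervalIntegral.integral_const_mul]
  refine Eq.trans ?_ ((integral_ite_sq_lt _ 1).trans (by rw [Real.sqrt_one, one_mul]))
  refine integral_congr_ae ?_
  filter_upwards [hint.prod_right_ae] with x hx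
  rw [Measure.volume_eq_prod] at hx ⊢
  rw [integral_prod _ hx, integral_integral_indicator_ballBasisSq, Real.sqrt_one, div_one]
  split_ifs with h
  · have hs : 0 < 1 - x ^ 2 := by linarith
    have hp : √(1 - x ^ 2) * ((1 - x ^ 2) ^ j * (1 - x ^ 2) ^ ((k : ℝ) + 1 / 2)) =
        (1 - x ^ 2) ^ ((j : ℝ) + (k : ℝ) + 3 / 2 - 1 / 2) := by
      rw [← mul_assoc, sqrt_mul_pow_eq_rpow hs.le, ← Real.rpow_add hs]
      congr 1
      ring
    rw [← hp]
    ring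
  · rw [Real.sqrt_eq_zero_of_nonpos (by linarith), zero_mul]

/-- the squared `L²(𝔹₃)`-norm of the unnormalized basis function
is the product `(N_k^{[1/2]})² (N_j^{[k+1]})² (N_{n-j-k}^{[j+k+3/2]})²`. -/
theorem h3_sq_eq_norm (n j k : ℕ) (hjk : j + k ≤ n) :
    (∫ p in unitBall3,
        (gegenbauer ((j : ℝ) + (k : ℝ) + 3 / 2) (n - j - k) p.1) ^ 2 *
          (1 - p.1 ^ 2) ^ j *
          (gegenbauer ((k : ℝ) + 1) j (p.2.1 / Real.sqrt (1 - p.1 ^ 2))) ^ 2 *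
          (1 - p.1 ^ 2 - p.2.1 ^ 2) ^ k *
          (gegenbauer (1 / 2) k
            (p.2.2 / Real.sqrt (1 - p.1 ^ 2 - p.2.1 ^ 2))) ^ 2) =
      Nsq (1 / 2) k * Nsq ((k : ℝ) + 1) j *
        Nsq ((j : ℝ) + (k : ℝ) + 3 / 2) (n - j - k) := by
  exact integral_ballBasisSq j k (n - j - k)
end

section
/- For every integer n ≥ 0, all integers j, k ≥ 0 with j + k ≤ n, and every (x,y,z) ∈ B₃: y·Q_n^{j,k}(x,y,z) = b⁺^{[n]}_{j,k}·Q_{n+1}^{j+1,k}(x,y,z) + b⁻^{[n]}_{j,k}·Q_{n+1}^{j−1,k}(x,y,z) + b⁻^{[n−1]}_{j+1,k}·Q_{n−1}^{j+1,k}(x,y,z) + b⁺^{[n−1]}_{j−1,k}·Q_{n−1}^{j−1,k}(x,y,z), where b⁺^{[m]}_{j,k} = (1/4)·√((j+2k+2)(j+1)(j+k+m+4)(j+k+m+3)/((j+k+1)(j+k+2)(m+5/2)(m+3/2))) and b⁻^{[m]}_{j,k} = −(1/4)·√(j(j+2k+1)(m+2−j−k)(m+1−j−k)/((j+k+1)(j+k)(m+3/2)(m+5/2))),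 with the convention that any term Q_m^{j′,k′} with j′ < 0 or j′ + k′ > m is taken to be 0. -/
open MeasureTheory Real Filter

/-- `Q_m^{j,k}` extended by the convention that it vanishes when `j < 0`,
`k < 0`, or `j + k > m`. -/
noncomputable def Q3ext (m j k : ℤ) (x y z : ℝ) : ℝ :=
  if 0 ≤ j ∧ 0 ≤ k ∧ j + k ≤ m then Q3 m.toNat j.toNat k.toNat x y z else 0

/-- The recursion coefficient `b⁺^{[m]}_{j,k}`. -/
noncomputable def b3p (j k m : ℤ) : ℝ :=
  (1 / 4) * Real.sqrt (((j : ℝ) + 2 * k + 2) * ((j : ℝ) + 1) *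
      ((j : ℝ) + k + m + 4) * ((j : ℝ) + k + m + 3) /
    (((j : ℝ) + k + 1) * ((j : ℝ) + k + 2) * ((m : ℝ) + 5 / 2) * ((m : ℝ) + 3 / 2)))

/-- The recursion coefficient `b⁻^{[m]}_{j,k}`. -/
noncomputable def b3m (j k m : ℤ) : ℝ :=
  -(1 / 4) * Real.sqrt ((j : ℝ) * ((j : ℝ) + 2 * k + 1) *
      ((m : ℝ) + 2 - j - k) * ((m : ℝ) + 1 - j - k) /
    (((j : ℝ) + k + 1) * ((j : ℝ) + k) * ((m : ℝ) + 3 / 2) * ((m : ℝ) + 5 / 2)))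

theorem gegenbauer_add_two (lam : ℝ) (n : ℕ) (t : ℝ) :
    gegenbauer lam (n + 2) t =
      (2 * (((n : ℝ) + 1) + lam) / ((n : ℝ) + 2)) * t * gegenbauer lam (n + 1) t
        - ((((n : ℝ) + 1) + 2 * lam - 1) / ((n : ℝ) + 2)) * gegenbauer lam n t := by
  rw [gegenbauer]

theorem mul_gegenbauer_succ {lam : ℝ} (hl : 0 < lam) (n : ℕ) (t : ℝ) :
    t * gegenbauer lam (n + 1) t =
      ((n : ℝ) + 2) / (2 * ((n : ℝ) + 1 + lam)) * gegenbauer lam (n + 2) t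
        + ((n : ℝ) + 2 * lam) / (2 * ((n : ℝ) + 1 + lam)) * gegenbauer lam n t := by
  rw [gegenbauer_add_two]
  field_simp
  ring

theorem mul_gegenbauer_zero {lam : ℝ} (hl : 0 < lam) (t : ℝ) :
    t * gegenbauer lam 0 t = 1 / (2 * lam) * gegenbauer lam 1 t := by
  simp only [gegenbauer]
  field_simp

/-- Raising the parameter: `C_n^λ` in terms of `C_n^{λ+1}` and `C_{n-2}^{λ+1}`. -/
theorem gegenbauer_raise {lam : ℝ} (hl : 0 < lam) (t : ℝ) (n : ℕ) :
    gegenbauer lam (n + 2) t = lam / ((n : ℝ) + 2 + lam) *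
      (gegenbauer (lam + 1) (n + 2) t - gegenbauer (lam + 1) n t) := by
  induction n using Nat.twoStepInduction with
  | zero =>
    simp only [gegenbauer]
    push_cast
    field_simp
    ring
  | one =>
    simp only [gegenbauer]
    push_cast
    field_simp
    ring
  | more n ih0 ih1 =>
    have e1 := gegenbauer_add_two (lam + 1) (n + 2) t
    have e2 := gegenbauer_add_two (lam + 1) n t
    rw [gegenbauer_add_two lam (n + 2), show n + 2 + 1 = n + 1 + 2 by ring, ih1, ih0]
    rw [show n + 2 + 1 = n + 1 + 2 by ring] at e1
    rw [e1]
    push_cast at e2 ⊢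
    have h : gegenbauer (lam + 1) n t =
        (2 * ((n : ℝ) + 2 + lam) * t * gegenbauer (lam + 1) (n + 1) t
          - ((n : ℝ) + 2) * gegenbauer (lam + 1) (n + 2) t) / ((n : ℝ) + 2 * lam + 2) := by
      rw [e2]
      field_simp
      ring
    rw [h]
    field_simp
    ring

/-- Lowering the parameter: `(1 - t²) C_n^{λ+1}` in terms of `C_n^λ` and `C_{n+2}^λ`. -/
theorem gegenbauer_lower {lam : ℝ} (hl : 0 < lam) (t : ℝ) (n : ℕ) :
    (1 - t ^ 2) * gegenbauer (lam + 1) n t = 1 / (4 * lam * ((n : ℝ) + lam + 1)) *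
      (((n : ℝ) + 2 * lam + 1) * ((n : ℝ) + 2 * lam) * gegenbauer lam n t
        - ((n : ℝ) + 1) * ((n : ℝ) + 2) * gegenbauer lam (n + 2) t) := by
  induction n using Nat.twoStepInduction with
  | zero =>
    simp only [gegenbauer]
    push_cast
    field_simp
    ring
  | one =>
    simp only [gegenbauer]
    push_cast
    field_simp
    ring
  | more n ih0 ih1 =>
    rw [gegenbauer_add_two (lam + 1) n]
    trans (2 * ((n : ℝ) + 1 + (lam + 1)) / ((n : ℝ) + 2)) * t *
        ((1 - t ^ 2) * gegenbauer (lam + 1) (n + 1) t)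
      - (((n : ℝ) + 1 + 2 * (lam + 1) - 1) / ((n : ℝ) + 2)) *
        ((1 - t ^ 2) * gegenbauer (lam + 1) n t)
    · ring
    rw [ih0, ih1, gegenbauer_add_two lam (n + 2), show n + 2 + 1 = n + 1 + 2 by ring,
      gegenbauer_add_two lam (n + 1), show n + 1 + 1 = n + 2 by ring,
      gegenbauer_add_two lam n]
    push_cast
    field_simp
    ring

theorem Nsq_pos {mu : ℝ} (hmu : 0 < mu) (m : ℕ) : 0 < Nsq mu m := by
  unfold Nsq
  have := Real.Gamma_pos_of_pos (show 0 < 2 * mu + m by positivity)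
  have := Real.Gamma_pos_of_pos hmu
  positivity

theorem Nsq_succ {mu : ℝ} (hmu : 0 < mu) (m : ℕ) :
    Nsq mu (m + 1) =
      Nsq mu m * ((2 * mu + m) * (mu + m) / (((m : ℝ) + 1) * (mu + m + 1))) := by
  unfold Nsq
  have h1 : Real.Gamma (2 * mu + (m + 1 : ℕ)) = (2 * mu + m) * Real.Gamma (2 * mu + m) := by
    rw [← Real.Gamma_add_one (by positivity)]
    push_cast
    ring_nf
  have := Real.Gamma_pos_of_pos hmu
  rw [h1, Nat.factorial_succ]
  push_cast
  field_simp
  ring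

theorem Nsq_add_one {mu : ℝ} (hmu : 0 < mu) (m : ℕ) :
    Nsq (mu + 1) m = Nsq mu m *
      ((2 * mu + m + 1) * (2 * mu + m) * (mu + m) / (4 * mu ^ 2 * (mu + m + 1))) := by
  unfold Nsq
  have h1 : Real.Gamma (2 * (mu + 1) + m) =
      (2 * mu + m + 1) * ((2 * mu + m) * Real.Gamma (2 * mu + m)) := by
    rw [← Real.Gamma_add_one (by positivity), ← Real.Gamma_add_one (by positivity)]
    ring_nf
  have hp : (2 : ℝ) ^ (2 * (mu + 1) - 1) = 4 * 2 ^ (2 * mu - 1) := by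
    rw [show 2 * (mu + 1) - 1 = 2 + (2 * mu - 1) by ring, Real.rpow_add two_pos]
    norm_num
  have := Real.Gamma_pos_of_pos hmu
  rw [h1, hp, Real.Gamma_add_one hmu.ne']
  field_simp
  ring

/-- The square of `h_{j,k,j+k+m}`. -/
noncomputable def h3sq (j k m : ℕ) : ℝ :=
  Nsq (1 / 2) k * Nsq ((k : ℝ) + 1) j * Nsq ((j : ℝ) + (k : ℝ) + 3 / 2) m

theorem h3sq_pos (j k m : ℕ) : 0 < h3sq j k m := by
  have h1 := Nsq_pos (show (0 : ℝ) < 1 / 2 by norm_num) k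
  have h2 := Nsq_pos (show (0 : ℝ) < (k : ℝ) + 1 by positivity) j
  have h3 := Nsq_pos (show (0 : ℝ) < (j : ℝ) + k + 3 / 2 by positivity) m
  unfold h3sq
  positivity

theorem h3sq_succ_left (j k m : ℕ) :
    h3sq (j + 1) k m = h3sq j k m *
      (((j : ℝ) + 2 * k + 2) * (j + k + 1) / (((j : ℝ) + 1) * (j + k + 2))) *
      ((2 * j + 2 * k + m + 4) * (2 * j + 2 * k + m + 3) * (j + k + m + 3 / 2) /
        (4 * ((j : ℝ) + k + 3 / 2) ^ 2 * (j + k + m + 5 / 2))) := by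
  unfold h3sq
  rw [Nsq_succ (by positivity), show ((j + 1 : ℕ) : ℝ) + k + 3 / 2 = (j + k + 3 / 2) + 1 by
    push_cast; ring, Nsq_add_one (mu := (j : ℝ) + k + 3 / 2) (by positivity)]
  field_simp
  ring

theorem h3sq_add_two_right (j k m : ℕ) :
    h3sq j k (m + 2) = h3sq j k m *
      ((2 * j + 2 * k + m + 4) * (2 * j + 2 * k + m + 3) * (j + k + m + 3 / 2) /
        (((m : ℝ) + 1) * (m + 2) * (j + k + m + 7 / 2))) := by
  unfold h3sq
  rw [Nsq_succ (by positivity), Nsq_succ (by positivity)]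
  push_cast
  field_simp
  ring

theorem h3_add (j k m : ℕ) : h3 j k (j + k + m) = √(h3sq j k m) := by
  unfold h3 h3sq
  rw [show j + k + m - j - k = m by omega]

theorem quarter_sqrt_mul_one_div_sqrt {S a b c : ℝ} (ha : 0 < a) (hb : 0 < b) (hc : 0 ≤ c)
    (h : S * a = 16 * c ^ 2 * b) : 1 / 4 * √S * (1 / √b) = c * (1 / √a) := by
  have h1 : √S * √a = 4 * c * √b := by
    rw [← Real.sqrt_mul' _ ha.le, h, show 16 * c ^ 2 * b = (4 * c) ^ 2 * b by ring,
      Real.sqrt_mul (by positivity), Real.sqrt_sq (by positivity)]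
  have := Real.sqrt_pos.2 ha
  have := Real.sqrt_pos.2 hb
  field_simp
  linarith

theorem b3p_div_h3_succ (j k m : ℕ) :
    b3p j k ((j + k + m : ℕ) : ℤ) * (1 / h3 (j + 1) k (j + 1 + k + m)) =
      ((j : ℝ) + 1) / (2 * (j + k + 1)) * ((j + k + 3 / 2) / (j + k + m + 3 / 2)) *
        (1 / h3 j k (j + k + m)) := by
  rw [h3_add, h3_add, b3p]
  refine quarter_sqrt_mul_one_div_sqrt (h3sq_pos _ _ _) (h3sq_pos _ _ _) (by positivity) ?_
  rw [h3sq_succ_left]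
  push_cast
  field_simp
  ring

theorem b3p_div_h3 (j k m : ℕ) :
    b3p j k ((j + k + m : ℕ) : ℤ) * (1 / h3 j k (j + k + m)) =
      ((j : ℝ) + 2 * k + 2) / (2 * (j + k + 2)) *
        ((2 * j + 2 * k + m + 4) * (2 * j + 2 * k + m + 3) /
          (4 * ((j : ℝ) + k + 3 / 2) * (j + k + m + 5 / 2))) *
        (1 / h3 (j + 1) k (j + 1 + k + m)) := by
  rw [h3_add, h3_add, b3p]
  refine quarter_sqrt_mul_one_div_sqrt (h3sq_pos _ _ _) (h3sq_pos _ _ _) (by positivity) ?_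
  rw [h3sq_succ_left]
  push_cast
  field_simp
  ring

theorem b3m_div_h3_pred (j k m : ℕ) :
    b3m ((j : ℤ) + 1) k ((j + 1 + k + m : ℕ) : ℤ) * (1 / h3 j k (j + k + (m + 2))) =
      -(((j : ℝ) + 2 * k + 2) / (2 * (j + k + 2)) *
        (((m : ℝ) + 1) * (m + 2) / (4 * ((j : ℝ) + k + 3 / 2) * (j + k + m + 5 / 2))) *
        (1 / h3 (j + 1) k (j + 1 + k + m))) := by
  rw [h3_add, h3_add, b3m, neg_mul, neg_mul]
  refine congrArg _ (quarter_sqrt_mul_one_div_sqrt (h3sq_pos _ _ _) (h3sq_pos _ _ _)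
    (by positivity) ?_)
  rw [h3sq_succ_left, h3sq_add_two_right]
  push_cast
  field_simp
  ring

theorem b3m_div_h3 (j k m : ℕ) :
    b3m ((j : ℤ) + 1) k ((j + 1 + k + m : ℕ) : ℤ) * (1 / h3 (j + 1) k (j + 1 + k + m)) =
      -(((j : ℝ) + 1) / (2 * (j + k + 1)) * ((j + k + 3 / 2) / (j + k + m + 7 / 2)) *
        (1 / h3 j k (j + k + (m + 2)))) := by
  rw [h3_add, h3_add, b3m, neg_mul, neg_mul]
  refine congrArg _ (quarter_sqrt_mul_one_div_sqrt (h3sq_pos _ _ _) (h3sq_pos _ _ _)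
    (by positivity) ?_)
  rw [h3sq_succ_left, h3sq_add_two_right]
  push_cast
  field_simp
  ring

/-- The factor of `Q_n^{j,k}` that depends on `k` only. -/
noncomputable def zFactor (k : ℕ) (x y z : ℝ) : ℝ :=
  (1 - x ^ 2 - y ^ 2) ^ ((k : ℝ) / 2) *
    gegenbauer (1 / 2) k (z / √(1 - x ^ 2 - y ^ 2))

theorem Q3_add {x : ℝ} (hx : 0 < 1 - x ^ 2) (j k m : ℕ) (y z : ℝ) :
    Q3 (j + k + m) j k x y z = 1 / h3 j k (j + k + m) *
      (gegenbauer ((j : ℝ) + k + 3 / 2) m x * √(1 - x ^ 2) ^ j *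
        gegenbauer ((k : ℝ) + 1) j (y / √(1 - x ^ 2)) * zFactor k x y z) := by
  have h : (1 - x ^ 2) ^ ((j : ℝ) / 2) = √(1 - x ^ 2) ^ j := by
    rw [Real.sqrt_eq_rpow, ← Real.rpow_mul_natCast hx.le]
    ring_nf
  unfold Q3 zFactor
  rw [h, show j + k + m - j - k = m by omega]
  ring

theorem Q3ext_natCast {j k n : ℕ} (h : j + k ≤ n) (x y z : ℝ) :
    Q3ext n j k x y z = Q3 n j k x y z := by
  unfold Q3ext
  rw [if_pos (by omega)]
  simp

theorem Q3ext_of_lt {n j k : ℤ} (h : n < j + k) (x y z : ℝ) : Q3ext n j k x y z = 0 :=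
  if_neg (by omega)

theorem Q3ext_of_neg {n j k : ℤ} (h : j < 0) (x y z : ℝ) : Q3ext n j k x y z = 0 :=
  if_neg (by omega)

/-- The two terms of the recursion with `j + 1`. -/
theorem b3p_mul_Q3ext_add_b3m_mul_Q3ext {x : ℝ} (hx : 0 < 1 - x ^ 2) (j k m : ℕ) (y z : ℝ) :
    b3p j k ((j + k + m : ℕ) : ℤ) *
        Q3ext (((j + k + m : ℕ) : ℤ) + 1) ((j : ℤ) + 1) k x y z +
      b3m ((j : ℤ) + 1) k (((j + k + m : ℕ) : ℤ) - 1) *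
        Q3ext (((j + k + m : ℕ) : ℤ) - 1) ((j : ℤ) + 1) k x y z =
    1 / h3 j k (j + k + m) * (((j : ℝ) + 1) / (2 * (j + k + 1))) *
      (gegenbauer ((j : ℝ) + k + 3 / 2) m x * √(1 - x ^ 2) ^ (j + 1) *
        gegenbauer ((k : ℝ) + 1) (j + 1) (y / √(1 - x ^ 2)) * zFactor k x y z) := by
  have hp := b3p_div_h3_succ j k m
  have hl : (0 : ℝ) < (j : ℝ) + k + 3 / 2 := by positivity
  rw [show ((j + k + m : ℕ) : ℤ) + 1 = ((j + 1 + k + m : ℕ) : ℤ) by push_cast; ring]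
  have hQ : Q3ext ((j + 1 + k + m : ℕ) : ℤ) ((j : ℤ) + 1) k x y z = _ :=
    (Q3ext_natCast (j := j + 1) (by omega) x y z).trans (Q3_add hx (j + 1) k m y z)
  rw [hQ, ← mul_assoc, hp,
    show ((j + 1 : ℕ) : ℝ) + k + 3 / 2 = (j + k + 3 / 2) + 1 by push_cast; ring]
  match m with
  | 0 =>
    rw [Q3ext_of_lt (by omega)]
    simp only [gegenbauer]
    push_cast
    field_simp
    ring
  | 1 =>
    rw [Q3ext_of_lt (by omega)]
    simp only [gegenbauer]
    push_cast
    field_simp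
    ring
  | m + 2 =>
    rw [show ((j + k + (m + 2) : ℕ) : ℤ) - 1 = ((j + 1 + k + m : ℕ) : ℤ) by push_cast; ring]
    have hQ : Q3ext ((j + 1 + k + m : ℕ) : ℤ) ((j : ℤ) + 1) k x y z = _ :=
      (Q3ext_natCast (j := j + 1) (by omega) x y z).trans (Q3_add hx (j + 1) k m y z)
    rw [hQ, ← mul_assoc (b3m _ _ _), b3m_div_h3, gegenbauer_raise hl,
      show ((j + 1 : ℕ) : ℝ) + k + 3 / 2 = (j + k + 3 / 2) + 1 by push_cast; ring,
      show (m : ℝ) + 2 + (j + k + 3 / 2) = j + k + m + 7 / 2 by ring,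
      show (j : ℝ) + k + (m + 2 : ℕ) + 3 / 2 = j + k + m + 7 / 2 by push_cast; ring]
    ring

/-- The two terms of the recursion with `j - 1`, for positive `j`. -/
theorem b3m_mul_Q3ext_add_b3p_mul_Q3ext {x : ℝ} (hx : 0 < 1 - x ^ 2) (j k m : ℕ) (y z : ℝ) :
    b3m ((j : ℤ) + 1) k ((j + 1 + k + m : ℕ) : ℤ) *
        Q3ext (((j + 1 + k + m : ℕ) : ℤ) + 1) j k x y z +
      b3p j k (((j + 1 + k + m : ℕ) : ℤ) - 1) *
        Q3ext (((j + 1 + k + m : ℕ) : ℤ) - 1) j k x y z =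
    1 / h3 (j + 1) k (j + 1 + k + m) * (((j : ℝ) + 2 * k + 2) / (2 * (j + k + 2))) *
      ((1 - x ^ 2) * gegenbauer ((j : ℝ) + k + 3 / 2 + 1) m x * √(1 - x ^ 2) ^ j *
        gegenbauer ((k : ℝ) + 1) j (y / √(1 - x ^ 2)) * zFactor k x y z) := by
  have hl : (0 : ℝ) < (j : ℝ) + k + 3 / 2 := by positivity
  rw [show ((j + 1 + k + m : ℕ) : ℤ) + 1 = ((j + k + (m + 2) : ℕ) : ℤ) by push_cast; ring,
    show ((j + 1 + k + m : ℕ) : ℤ) - 1 = ((j + k + m : ℕ) : ℤ) by push_cast; ring,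
    Q3ext_natCast (by omega), Q3ext_natCast (by omega), Q3_add hx, Q3_add hx,
    ← mul_assoc (b3m _ _ _), ← mul_assoc (b3p _ _ _), b3m_div_h3_pred, b3p_div_h3,
    gegenbauer_lower hl,
    show (m : ℝ) + (j + k + 3 / 2) + 1 = j + k + m + 5 / 2 by ring]
  ring

/-- the `y`-direction triple recursion relation for the `Q_n^{j,k}`. -/
theorem Q3_recursion_y (n j k : ℕ) (hjk : j + k ≤ n) (x y z : ℝ)
    (hxyz : (x, y, z) ∈ unitBall3) :
    y * Q3 n j k x y z =
      b3p j k n * Q3ext ((n : ℤ) + 1) ((j : ℤ) + 1) k x y z +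
      b3m j k n * Q3ext ((n : ℤ) + 1) ((j : ℤ) - 1) k x y z +
      b3m ((j : ℤ) + 1) k ((n : ℤ) - 1) * Q3ext ((n : ℤ) - 1) ((j : ℤ) + 1) k x y z +
      b3p ((j : ℤ) - 1) k ((n : ℤ) - 1) * Q3ext ((n : ℤ) - 1) ((j : ℤ) - 1) k x y z := by
  have hlt : x ^ 2 + y ^ 2 + z ^ 2 < 1 := hxyz
  have hx : 0 < 1 - x ^ 2 := by nlinarith [sq_nonneg y, sq_nonneg z]
  have hr : 0 < √(1 - x ^ 2) := Real.sqrt_pos.2 hx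
  have hk : (0 : ℝ) < (k : ℝ) + 1 := by positivity
  obtain ⟨m, rfl⟩ := Nat.exists_eq_add_of_le hjk
  have hy : y = √(1 - x ^ 2) * (y / √(1 - x ^ 2)) := by field_simp
  have hp := b3p_mul_Q3ext_add_b3m_mul_Q3ext hx j k m y z
  rw [Q3_add hx]
  match j with
  | 0 =>
    have ht := mul_gegenbauer_zero hk (y / √(1 - x ^ 2))
    rw [Q3ext_of_neg (n := ((0 + k + m : ℕ) : ℤ) + 1) (j := ((0 : ℕ) : ℤ) - 1) (by omega),
      Q3ext_of_neg (n := ((0 + k + m : ℕ) : ℤ) - 1) (j := ((0 : ℕ) : ℤ) - 1) (by omega)]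
    simp only [CharP.cast_eq_zero, zero_add, pow_one] at hp ⊢
    generalize y / √(1 - x ^ 2) = t at *
    generalize √(1 - x ^ 2) = r at *
    linear_combination -hp +
      r * (1 / h3 0 k (k + m)) * gegenbauer ((k : ℝ) + 3 / 2) m x * zFactor k x y z * ht +
      1 / h3 0 k (k + m) * gegenbauer ((k : ℝ) + 3 / 2) m x * gegenbauer ((k : ℝ) + 1) 0 t *
        zFactor k x y z * hy
  | j + 1 =>
    have hm := b3m_mul_Q3ext_add_b3p_mul_Q3ext hx j k m y z
    have ht := mul_gegenbauer_succ hk j (y / √(1 - x ^ 2))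
    have hs : √(1 - x ^ 2) ^ 2 = 1 - x ^ 2 := Real.sq_sqrt hx.le
    have hl : ((j + 1 : ℕ) : ℝ) + k + 3 / 2 = j + k + 3 / 2 + 1 := by
      push_cast
      ring
    rw [hl, Nat.cast_succ (R := ℤ)] at hp ⊢
    rw [add_sub_cancel_right (j : ℤ) 1]
    push_cast at hp
    rw [show (j : ℝ) + 1 + k + 1 = j + k + 2 by ring] at hp
    rw [show (j : ℝ) + 1 + (k + 1) = j + k + 2 by ring] at ht
    push_cast at hm ⊢
    generalize y / √(1 - x ^ 2) = t at *
    generalize √(1 - x ^ 2) = r at *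
    rw [← hs] at hm
    linear_combination -hp - hm +
      r ^ (j + 2) * (1 / h3 (j + 1) k (j + 1 + k + m)) *
        gegenbauer ((j : ℝ) + k + 3 / 2 + 1) m x * zFactor k x y z * ht +
      1 / h3 (j + 1) k (j + 1 + k + m) * gegenbauer ((j : ℝ) + k + 3 / 2 + 1) m x *
        r ^ (j + 1) * gegenbauer ((k : ℝ) + 1) (j + 1) t * zFactor k x y z * hy
end
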